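/- Let ε_n, ρ_n ∈ (0,1) be sequences with ε_n·n/log n → ∞ as n → ∞. Then there exist a constant K, an index n₀, and for each n an ε_n-node differentially private algorithm A_n mapping graphs on n vertices to probability measures on ℝ, such that for every n ≥ n₀ and every integer m < ρ_n·C(n,2), E_{G ∼ G(n,m), x ∼ A_n(G)}[|x − m/C(n,2)|²] ≤ K·max{ρ_n, (log n)/n}·(log n)/(n³·ε_n²). -/

import Mathlib

open MeasureTheory ProbabilityTheory

noncomputable section

instance {n : ℕ} : MeasurableSpace (SimpleGraph (Fin n)) := ⊤

/-- The number of edges of a simple graph on `n` vertices. -/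
def edgeCount {n : ℕ} (G : SimpleGraph (Fin n)) : ℕ := G.edgeSet.ncard

/-- `G'` is obtained from `G` by rewiring a single vertex. -/
def Rewire {n : ℕ} (G G' : SimpleGraph (Fin n)) : Prop :=
  ∃ v : Fin n, ∀ a b : Fin n, a ≠ v → b ≠ v → (G.Adj a b ↔ G'.Adj a b)

/-- The node (rewiring) distance between two graphs on `n` vertices. -/
def nodeDist {n : ℕ} (G G' : SimpleGraph (Fin n)) : ℕ :=
  sInf {m : ℕ | ∃ f : ℕ → SimpleGraph (Fin n),
    f 0 = G ∧ f m = G' ∧ ∀ i < m, Rewire (f i) (f (i + 1))}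

/-- The uniform distribution `G(n,m)` on graphs on `n` vertices with exactly `m` edges. -/
def gnm (n m : ℕ) : Measure (SimpleGraph (Fin n)) :=
  uniformOn {G : SimpleGraph (Fin n) | edgeCount G = m}

/-- Falling-factorial comparison: `C(f,j) N^j ≤ C(N,j) f^j` for `f ≤ N`. -/
lemma choose_mul_pow_le (f N j : ℕ) (h : f ≤ N) :
    f.choose j * N ^ j ≤ N.choose j * f ^ j := by
  have key : f.descFactorial j * N ^ j ≤ N.descFactorial j * f ^ j := by
    induction j with
    | zero => simp
    | succ j ih =>
      rw [Nat.descFactorial_succ, Nat.descFactorial_succ, pow_succ, pow_succ]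
      have h1 : (f - j) * N ≤ (N - j) * f := by
        rcases le_total f j with hj | hj
        · simp [Nat.sub_eq_zero_of_le hj]
        · zify [hj, hj.trans h]
          have : (f : ℤ) ≤ N := by exact_mod_cast h
          nlinarith [mul_nonneg (Int.natCast_nonneg j) (sub_nonneg.2 this)]
      calc (f - j) * f.descFactorial j * (N ^ j * N)
          = ((f - j) * N) * (f.descFactorial j * N ^ j) := by ring
        _ ≤ ((N - j) * f) * (N.descFactorial j * f ^ j) := Nat.mul_le_mul h1 ih
        _ = _ := by ring
  rw [Nat.descFactorial_eq_factorial_mul_choose, Nat.descFactorial_eq_factorial_mul_choose,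
    mul_assoc, mul_assoc] at key
  exact Nat.le_of_mul_le_mul_left key (Nat.factorial_pos j)

/-- Hypergeometric moment generating function bound (sampling without replacement is
dominated by sampling with replacement). -/
lemma hyper_mgf {α : Type*} [DecidableEq α] (E F : Finset α) (hF : F ⊆ E) (hE : 0 < E.card)
    (m : ℕ) (y : ℝ) (hy : 0 ≤ y) :
    ∑ M ∈ E.powersetCard m, (1 + y) ^ (M ∩ F).card
      ≤ (E.card.choose m : ℝ) * (1 + (F.card : ℝ) / E.card * y) ^ m := by
  have h1 : ∀ M ∈ E.powersetCard m, (1 + y) ^ (M ∩ F).card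
      = ∑ J ∈ F.powerset, if J ⊆ M then y ^ J.card else 0 := by
    intro M _
    rw [← Finset.sum_filter, add_comm]
    have := Finset.sum_pow_mul_eq_add_pow y 1 (M ∩ F)
    simp only [one_pow, mul_one] at this
    rw [← this]
    apply Finset.sum_congr _ (fun _ _ => rfl)
    ext J
    simp only [Finset.mem_powerset, Finset.mem_filter, Finset.subset_inter_iff]
    tauto
  rw [Finset.sum_congr rfl h1, Finset.sum_comm]
  have hNpos : (0 : ℝ) < E.card := by exact_mod_cast hE
  set q : ℝ := (F.card : ℝ) / E.card with hq
  have hq0 : 0 ≤ q := by positivity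
  have h2 : ∀ J ∈ F.powerset, (∑ M ∈ E.powersetCard m, if J ⊆ M then y ^ J.card else 0)
      = (fun j : ℕ => if j ≤ m then y ^ j * ((E.card - j).choose (m - j) : ℝ) else 0) J.card := by
    intro J hJ
    rw [← Finset.sum_filter, Finset.sum_const, nsmul_eq_mul]
    by_cases hj : J.card ≤ m
    · simp only [hj, if_true]
      rw [Finset.card_filter_powersetCard_subset J E m ((Finset.mem_powerset.1 hJ).trans hF) hj,
        mul_comm]
    · simp only [hj, if_false]
      have : (E.powersetCard m).filter (fun M => J ⊆ M) = ∅ := by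
        apply Finset.filter_eq_empty_iff.2
        intro M hM hJM
        have := Finset.card_le_card hJM
        rw [(Finset.mem_powersetCard.1 hM).2] at this
        exact hj this
      rw [this]; simp
  rw [Finset.sum_congr rfl h2, Finset.sum_powerset_apply_card
    (fun j : ℕ => if j ≤ m then y ^ j * ((E.card - j).choose (m - j) : ℝ) else 0)]
  have h3 : ∀ j, (F.card.choose j) • (fun j : ℕ => if j ≤ m then y ^ j * ((E.card - j).choose (m - j) : ℝ) else 0) j
      ≤ (E.card.choose m : ℝ) * ((q * y) ^ j * (m.choose j : ℝ)) := by
    intro j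
    rw [nsmul_eq_mul]
    by_cases hj : j ≤ m
    · simp only [hj, if_true]
      have e1 : (E.card.choose m : ℝ) * (m.choose j : ℝ)
        = (E.card.choose j : ℝ) * ((E.card - j).choose (m - j) : ℝ) := by
        exact_mod_cast Nat.choose_mul (n := E.card) hj
      have e2 : (F.card.choose j : ℝ) ≤ (E.card.choose j : ℝ) * q ^ j := by
        rw [hq, div_pow, ← mul_div_assoc, le_div_iff₀ (by positivity)]
        exact_mod_cast choose_mul_pow_le F.card E.card j (Finset.card_le_card hF)
      calc (F.card.choose j : ℝ) * (y ^ j * ((E.card - j).choose (m - j) : ℝ))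
          ≤ ((E.card.choose j : ℝ) * q ^ j) * (y ^ j * ((E.card - j).choose (m - j) : ℝ)) := by
            gcongr
        _ = (q * y) ^ j * ((E.card.choose j : ℝ) * ((E.card - j).choose (m - j) : ℝ)) := by
            rw [mul_pow]; ring
        _ = _ := by rw [← e1]; ring
    · simp only [hj, if_false, mul_zero]
      positivity
  refine (Finset.sum_le_sum (fun j _ => h3 j)).trans ?_
  rw [← Finset.mul_sum]
  gcongr
  rw [add_comm 1 (q * y), add_pow]
  simp only [one_pow, mul_one]
  calc ∑ j ∈ Finset.range (F.card + 1), (q * y) ^ j * (m.choose j : ℝ)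
      ≤ ∑ j ∈ Finset.range (F.card + m + 1), (q * y) ^ j * (m.choose j : ℝ) := by
        apply Finset.sum_le_sum_of_subset_of_nonneg
        · intro j; simp; omega
        · intros; positivity
    _ = ∑ j ∈ Finset.range (m + 1), (q * y) ^ j * (m.choose j : ℝ) := by
        symm
        apply Finset.sum_subset
        · intro j; simp; omega
        · intro j _ hj
          rw [Nat.choose_eq_zero_of_lt (by simpa using hj)]; simp

/-- Chernoff upper tail for the hypergeometric distribution, in counting form. -/
lemma hyper_upper {α : Type*} [DecidableEq α] (E F : Finset α) (hF : F ⊆ E) (hE : 0 < E.card)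
    (m : ℕ) (t lam : ℝ) (h0 : 0 ≤ lam) (h1 : lam ≤ 1) :
    (((E.powersetCard m).filter
        (fun M => (m : ℝ) * (F.card / E.card) + t ≤ ((M ∩ F).card : ℝ))).card : ℝ)
      ≤ (E.card.choose m : ℝ)
        * Real.exp ((m : ℝ) * (F.card / E.card) * lam ^ 2 - lam * t) := by
  set q : ℝ := (F.card : ℝ) / E.card with hq
  have hq0 : 0 ≤ q := by positivity
  have hexp : 0 ≤ Real.exp lam - 1 := by linarith [Real.add_one_le_exp lam]
  have hm := hyper_mgf E F hF hE m _ hexp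
  rw [← hq] at hm
  have hA : (((E.powersetCard m).filter
        (fun M => (m : ℝ) * q + t ≤ ((M ∩ F).card : ℝ))).card : ℝ) * Real.exp (lam * (m * q + t))
      ≤ ∑ M ∈ E.powersetCard m, (1 + (Real.exp lam - 1)) ^ (M ∩ F).card := by
    rw [← nsmul_eq_mul, ← Finset.sum_const]
    refine (Finset.sum_le_sum ?_).trans (Finset.sum_le_sum_of_subset_of_nonneg
      (Finset.filter_subset _ _) ?_)
    · intro M hM
      rw [add_sub_cancel, ← Real.exp_nat_mul]
      apply Real.exp_le_exp.2
      have := (Finset.mem_filter.1 hM).2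
      nlinarith
    · intro M _ _
      rw [add_sub_cancel]; positivity
  have hB : (1 + q * (Real.exp lam - 1)) ^ m ≤ Real.exp (m * q * (lam + lam ^ 2)) := by
    have hb := (abs_le.1 (Real.abs_exp_sub_one_sub_id_le (x := lam)
      (abs_le.2 ⟨by linarith, h1⟩))).2
    calc (1 + q * (Real.exp lam - 1)) ^ m ≤ (Real.exp (q * (lam + lam ^ 2))) ^ m := by
          apply pow_le_pow_left₀ (by positivity)
          have := Real.add_one_le_exp (q * (lam + lam ^ 2))
          nlinarith
      _ = _ := by rw [← Real.exp_nat_mul]; congr 1; ring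
  have hC := hA.trans (hm.trans (mul_le_mul_of_nonneg_left hB (by positivity)))
  rw [← le_div_iff₀ (Real.exp_pos _), mul_div_assoc, ← Real.exp_sub] at hC
  refine hC.trans_eq ?_
  congr 2
  ring

/-- Chernoff lower tail for the hypergeometric distribution, in counting form. -/
lemma hyper_lower {α : Type*} [DecidableEq α] (E F : Finset α) (hF : F ⊆ E) (hE : 0 < E.card)
    (m : ℕ) (t lam : ℝ) (h0 : 0 ≤ lam) (h1 : lam ≤ 1) :
    (((E.powersetCard m).filter
        (fun M => ((M ∩ F).card : ℝ) ≤ (m : ℝ) * (F.card / E.card) - t)).card : ℝ)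
      ≤ (E.card.choose m : ℝ)
        * Real.exp ((m : ℝ) * (F.card / E.card) * lam ^ 2 - lam * t) := by
  have hNpos : (0 : ℝ) < E.card := by exact_mod_cast hE
  have hexp : 0 ≤ Real.exp lam - 1 := by linarith [Real.add_one_le_exp lam]
  have hm := hyper_mgf E (E \ F) Finset.sdiff_subset hE m _ hexp
  have hFE : (F.card : ℝ) ≤ E.card := by exact_mod_cast Finset.card_le_card hF
  have hcard : ((E \ F).card : ℝ) / E.card = 1 - F.card / E.card := by
    rw [Finset.card_sdiff_of_subset hF, Nat.cast_sub (Finset.card_le_card hF)]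
    field_simp
  rw [hcard] at hm
  set q : ℝ := (F.card : ℝ) / E.card with hq
  have hq0 : 0 ≤ q := by positivity
  have hq1 : q ≤ 1 := by rw [hq, div_le_one hNpos]; exact hFE
  have hA : (((E.powersetCard m).filter
        (fun M => ((M ∩ F).card : ℝ) ≤ (m : ℝ) * q - t)).card : ℝ)
          * Real.exp (lam * (m - (m * q - t)))
      ≤ ∑ M ∈ E.powersetCard m, (1 + (Real.exp lam - 1)) ^ (M ∩ (E \ F)).card := by
    rw [← nsmul_eq_mul, ← Finset.sum_const]
    refine (Finset.sum_le_sum ?_).trans (Finset.sum_le_sum_of_subset_of_nonneg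
      (Finset.filter_subset _ _) ?_)
    · intro M hM
      rw [add_sub_cancel, ← Real.exp_nat_mul]
      apply Real.exp_le_exp.2
      obtain ⟨hM1, hM2⟩ := Finset.mem_filter.1 hM
      obtain ⟨hM3, hM4⟩ := Finset.mem_powersetCard.1 hM1
      have e1 : (M ∩ F).card + (M ∩ (E \ F)).card = m := by
        rw [← hM4, ← Finset.card_inter_add_card_sdiff M F]
        congr 2
        ext x; simp only [Finset.mem_inter, Finset.mem_sdiff]
        exact ⟨fun h => ⟨h.1, h.2.2⟩, fun h => ⟨h.1, hM3 h.1, h.2⟩⟩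
      have e2 : ((M ∩ F).card : ℝ) + (M ∩ (E \ F)).card = m := by exact_mod_cast e1
      nlinarith
    · intro M _ _
      rw [add_sub_cancel]; positivity
  have hB : (1 + (1 - q) * (Real.exp lam - 1)) ^ m ≤ Real.exp (m * (lam + q * (- lam + lam ^ 2))) := by
    have hb := (abs_le.1 (Real.abs_exp_sub_one_sub_id_le (x := -lam)
      (by rw [abs_neg]; exact abs_le.2 ⟨by linarith, h1⟩))).2
    have e : 1 + (1 - q) * (Real.exp lam - 1) = Real.exp lam * (1 + q * (Real.exp (-lam) - 1)) := by
      rw [Real.exp_neg]; field_simp; ring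
    calc (1 + (1 - q) * (Real.exp lam - 1)) ^ m
          ≤ (Real.exp lam * Real.exp (q * (- lam + lam ^ 2))) ^ m := by
          apply pow_le_pow_left₀ (by nlinarith)
          rw [e]
          gcongr
          have := Real.add_one_le_exp (q * (- lam + lam ^ 2))
          nlinarith
      _ = _ := by rw [← Real.exp_add, ← Real.exp_nat_mul]
  have hC := hA.trans (hm.trans (mul_le_mul_of_nonneg_left hB (by positivity)))
  rw [← le_div_iff₀ (Real.exp_pos _), mul_div_assoc, ← Real.exp_sub] at hC
  refine hC.trans_eq ?_
  congr 2
  ring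

/-- The edge set as a finset. -/
def es {n : ℕ} (G : SimpleGraph (Fin n)) : Finset (Sym2 (Fin n)) := G.edgeSet.toFinite.toFinset

lemma mem_es {n : ℕ} (G : SimpleGraph (Fin n)) (e : Sym2 (Fin n)) : e ∈ es G ↔ e ∈ G.edgeSet := by
  simp [es]

lemma card_es {n : ℕ} (G : SimpleGraph (Fin n)) : (es G).card = edgeCount G :=
  (Set.ncard_eq_toFinset_card _ _).symm

lemma es_injective {n : ℕ} : Function.Injective (es : SimpleGraph (Fin n) → _) := by
  intro G H h
  apply SimpleGraph.edgeSet_injective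
  ext e
  rw [← mem_es, ← mem_es, h]

/-- All pairs of vertices. -/
def allE (n : ℕ) : Finset (Sym2 (Fin n)) := es ⊤

lemma card_allE (n : ℕ) : (allE n).card = n.choose 2 := by
  have := SimpleGraph.card_edgeFinset_top_eq_card_choose_two (V := Fin n)
  rw [Fintype.card_fin] at this
  rw [← this]
  congr 1
  ext e
  simp [allE, mem_es]

lemma es_subset {n : ℕ} (G : SimpleGraph (Fin n)) : es G ⊆ allE n := by
  intro e he
  rw [allE, mem_es]
  exact SimpleGraph.edgeSet_subset_edgeSet.2 le_top ((mem_es _ _).1 he)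

lemma exists_es {n : ℕ} (M : Finset (Sym2 (Fin n))) (hM : M ⊆ allE n) :
    ∃ G : SimpleGraph (Fin n), es G = M := by
  refine ⟨SimpleGraph.fromEdgeSet (M : Set _), ?_⟩
  ext e
  rw [mem_es, SimpleGraph.edgeSet_fromEdgeSet]
  constructor
  · intro h; exact h.1
  · intro h
    refine ⟨h, ?_⟩
    have := hM h
    rw [allE, mem_es] at this
    exact SimpleGraph.not_isDiag_of_mem_edgeSet _ this

open scoped Classical in
/-- The pairs of vertices meeting `T`. -/
def touch {n : ℕ} (T : Finset (Fin n)) : Finset (Sym2 (Fin n)) :=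
  (allE n).filter (fun e => ∃ v ∈ T, v ∈ e)

lemma touch_subset {n : ℕ} (T : Finset (Fin n)) : touch T ⊆ allE n := Finset.filter_subset _ _

lemma card_touch_le {n : ℕ} (T : Finset (Fin n)) : (touch T).card ≤ T.card * n := by
  classical
  have : touch T ⊆ (T ×ˢ (Finset.univ : Finset (Fin n))).image (fun p => s(p.1, p.2)) := by
    intro e he
    simp only [touch, Finset.mem_filter] at he
    obtain ⟨_, v, hv, hve⟩ := he
    obtain ⟨w, rfl⟩ := Sym2.mem_iff_exists.1 hve
    exact Finset.mem_image.2 ⟨(v, w), by simp [hv], rfl⟩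
  refine (Finset.card_le_card this).trans (Finset.card_image_le.trans ?_)
  simp

lemma touch_empty {n : ℕ} : touch (∅ : Finset (Fin n)) = ∅ := by
  classical
  simp [touch]

open scoped Classical in
/-- Homogeneous graphs: for every vertex set `T`, the number of edges meeting `T` is close to
what is expected from the edge density. -/
def Hom {n : ℕ} (Δ : ℝ) (G : SimpleGraph (Fin n)) : Prop :=
  ∀ T : Finset (Fin n), |((es G ∩ touch T).card : ℝ)
    - (edgeCount G : ℝ) * ((touch T).card / (allE n).card)| ≤ T.card * Δ

lemma card_graphs (n m : ℕ) [DecidablePred fun G : SimpleGraph (Fin n) => edgeCount G = m]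
    [Fintype (SimpleGraph (Fin n))] :
    (Finset.univ.filter (fun G : SimpleGraph (Fin n) => edgeCount G = m)).card
      = (allE n).card.choose m := by
  rw [← Finset.card_powersetCard]
  refine Finset.card_bij (fun G _ => es G) ?_ ?_ ?_
  · intro G hG
    rw [Finset.mem_powersetCard, card_es]
    exact ⟨es_subset G, by simpa using hG⟩
  · intro G _ H _ h
    exact es_injective h
  · intro M hM
    obtain ⟨h1, h2⟩ := Finset.mem_powersetCard.1 hM
    obtain ⟨G, rfl⟩ := exists_es M h1
    exact ⟨G, by simpa [card_es] using h2, rfl⟩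

open scoped Classical in
lemma card_bad (n m : ℕ) (hn : 0 < (allE n).card) (σ lam Δ : ℝ) (h0 : 0 ≤ lam) (h1 : lam ≤ 1)
    (hσ : (m : ℝ) * n / (allE n).card ≤ σ) :
    ((Finset.univ.filter (fun G : SimpleGraph (Fin n) => edgeCount G = m ∧ ¬ Hom Δ G)).card : ℝ)
      ≤ ((allE n).card.choose m : ℝ) *
        (2 * ((1 + Real.exp (σ * lam ^ 2 - lam * Δ)) ^ n - 1)) := by
  have hNpos : (0 : ℝ) < (allE n).card := by exact_mod_cast hn
  set C : ℝ := ((allE n).card.choose m : ℝ)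
  set up : Finset (Fin n) → Finset (Finset (Sym2 (Fin n))) := fun T =>
    ((allE n).powersetCard m).filter (fun M => (m : ℝ) * ((touch T).card / (allE n).card)
      + T.card * Δ ≤ ((M ∩ touch T).card : ℝ)) with hup
  set dn : Finset (Fin n) → Finset (Finset (Sym2 (Fin n))) := fun T =>
    ((allE n).powersetCard m).filter (fun M => ((M ∩ touch T).card : ℝ) ≤
      (m : ℝ) * ((touch T).card / (allE n).card) - T.card * Δ) with hdn
  set bad := Finset.univ.filter (fun G : SimpleGraph (Fin n) => edgeCount G = m ∧ ¬ Hom Δ G)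
  set Ts := (Finset.univ : Finset (Finset (Fin n))).erase ∅
  have hsub : bad.image es ⊆ Ts.biUnion (fun T => up T ∪ dn T) := by
    intro M hM
    obtain ⟨G, hG, rfl⟩ := Finset.mem_image.1 hM
    simp only [bad, Finset.mem_filter, Finset.mem_univ, true_and, Hom, not_forall] at hG
    obtain ⟨hm, T, hT⟩ := hG
    have hT0 : T ≠ ∅ := by
      rintro rfl
      apply hT
      simp [touch_empty]
    have hmem : es G ∈ (allE n).powersetCard m :=
      Finset.mem_powersetCard.2 ⟨es_subset G, by rw [card_es, hm]⟩
    rw [Finset.mem_biUnion]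
    refine ⟨T, by simp [Ts, hT0], ?_⟩
    rw [hm, abs_le, not_and_or, not_le, not_le] at hT
    rw [Finset.mem_union]
    rcases hT with hT | hT
    · right
      exact Finset.mem_filter.2 ⟨hmem, by linarith⟩
    · left
      exact Finset.mem_filter.2 ⟨hmem, by linarith⟩
  have hcard : bad.card ≤ ∑ T ∈ Ts, ((up T).card + (dn T).card) := by
    rw [← Finset.card_image_of_injective bad es_injective]
    refine (Finset.card_le_card hsub).trans (Finset.card_biUnion_le.trans ?_)
    exact Finset.sum_le_sum (fun T _ => Finset.card_union_le _ _)
  set x := Real.exp (σ * lam ^ 2 - lam * Δ) with hx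
  have hexp : ∀ T : Finset (Fin n), Real.exp ((m : ℝ) * ((touch T).card / (allE n).card) * lam ^ 2
      - lam * (T.card * Δ)) ≤ x ^ T.card := by
    intro T
    rw [hx, ← Real.exp_nat_mul]
    apply Real.exp_le_exp.2
    have h2 : (m : ℝ) * ((touch T).card / (allE n).card) ≤ T.card * σ := by
      have : ((touch T).card : ℝ) ≤ T.card * n := by exact_mod_cast card_touch_le T
      calc (m : ℝ) * ((touch T).card / (allE n).card)
          ≤ (m : ℝ) * ((T.card * n) / (allE n).card) := by gcongr
        _ = T.card * ((m : ℝ) * n / (allE n).card) := by ring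
        _ ≤ _ := by gcongr
    nlinarith [mul_le_mul_of_nonneg_right h2 (sq_nonneg lam)]
  have hTb : ∀ T, ((up T).card : ℝ) + (dn T).card ≤ C * (2 * x ^ T.card) := by
    intro T
    have a1 := hyper_upper (allE n) (touch T) (touch_subset T) hn m (T.card * Δ) lam h0 h1
    have a2 := hyper_lower (allE n) (touch T) (touch_subset T) hn m (T.card * Δ) lam h0 h1
    have hC : 0 ≤ C := by positivity
    have := mul_le_mul_of_nonneg_left (hexp T) hC
    simp only [hup, hdn]
    linarith
  have hsum : ∑ T ∈ Ts, x ^ T.card = (1 + x) ^ n - 1 := by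
    have e := Fintype.sum_pow_mul_eq_add_pow (Fin n) x 1
    simp only [one_pow, mul_one, Fintype.card_fin] at e
    rw [add_comm 1 x, ← e, ← Finset.add_sum_erase _ _ (Finset.mem_univ (∅ : Finset (Fin n)))]
    simp [Ts]
  calc (bad.card : ℝ) ≤ ∑ T ∈ Ts, (((up T).card : ℝ) + (dn T).card) := by exact_mod_cast hcard
    _ ≤ ∑ T ∈ Ts, C * (2 * x ^ T.card) := Finset.sum_le_sum (fun T _ => hTb T)
    _ = C * (2 * ∑ T ∈ Ts, x ^ T.card) := by rw [← Finset.mul_sum, ← Finset.mul_sum]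
    _ = _ := by rw [hsum]

/-- Under `G(n,m)`, non-homogeneous graphs are rare. -/
lemma gnm_bad (n m : ℕ) (hn : 0 < (allE n).card) (σ lam Δ : ℝ) (h0 : 0 ≤ lam) (h1 : lam ≤ 1)
    (hσ : (m : ℝ) * n / (allE n).card ≤ σ) :
    (gnm n m).real {G | ¬ Hom Δ G} ≤ 2 * ((1 + Real.exp (σ * lam ^ 2 - lam * Δ)) ^ n - 1) := by
  classical
  set s := Finset.univ.filter (fun G : SimpleGraph (Fin n) => edgeCount G = m) with hs
  set t := Finset.univ.filter (fun G : SimpleGraph (Fin n) => ¬ Hom Δ G) with ht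
  have e1 : {G : SimpleGraph (Fin n) | edgeCount G = m} = (s : Set _) := by ext; simp [s]
  have e2 : {G : SimpleGraph (Fin n) | ¬ Hom Δ G} = (t : Set _) := by ext; simp [t]
  have hx : 0 ≤ 2 * ((1 + Real.exp (σ * lam ^ 2 - lam * Δ)) ^ n - 1) := by
    have : 1 ≤ (1 + Real.exp (σ * lam ^ 2 - lam * Δ)) ^ n :=
      one_le_pow₀ (by linarith [Real.exp_pos (σ * lam ^ 2 - lam * Δ)])
    linarith
  have hmeas : gnm n m {G | ¬ Hom Δ G} = (s ∩ t).card / s.card := by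
    rw [gnm, e1, e2]
    exact uniformOn_apply_finset' (MeasurableSpace.measurableSet_top)
      (MeasurableSpace.measurableSet_top)
  rw [Measure.real, hmeas, ENNReal.toReal_div, ENNReal.toReal_natCast, ENNReal.toReal_natCast]
  have hst : s ∩ t = Finset.univ.filter
      (fun G : SimpleGraph (Fin n) => edgeCount G = m ∧ ¬ Hom Δ G) := by
    rw [hs, ht, ← Finset.filter_and]
  apply div_le_of_le_mul₀ (by positivity) hx
  rw [hst, hs, card_graphs, mul_comm]
  exact card_bad n m hn σ lam Δ h0 h1 hσ

/-- `G` and `H` agree outside the vertex set `T`. -/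
def Agree {n : ℕ} (G H : SimpleGraph (Fin n)) (T : Finset (Fin n)) : Prop :=
  ∀ a b : Fin n, a ∉ T → b ∉ T → (G.Adj a b ↔ H.Adj a b)

/-- Flattened linear score for homogeneous graphs. -/
def flat {n : ℕ} (L B : ℝ) (H : SimpleGraph (Fin n)) (j : ℕ) : ℝ :=
  min (L * |(j : ℝ) - edgeCount H|) B

/-- Lipschitz extension of the flattened score to all graphs. -/
def score {n : ℕ} (ε Δ L B : ℝ) (G : SimpleGraph (Fin n)) (j : ℕ) : ℝ :=
  sInf ((fun p : SimpleGraph (Fin n) × Finset (Fin n) => flat L B p.1 j + ε / 2 * p.2.card) ''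
    {p | Hom Δ p.1 ∧ Agree G p.1 p.2})

lemma hom_bot {n : ℕ} (Δ : ℝ) (hΔ : 0 ≤ Δ) : Hom Δ (⊥ : SimpleGraph (Fin n)) := by
  classical
  intro T
  have h1 : es (⊥ : SimpleGraph (Fin n)) = ∅ := by
    ext e; rw [mem_es]; simp
  have h2 : edgeCount (⊥ : SimpleGraph (Fin n)) = 0 := by rw [← card_es, h1]; simp
  rw [h1, h2]
  simp only [Finset.empty_inter, Finset.card_empty, Nat.cast_zero, zero_mul, sub_zero, abs_zero]
  positivity

lemma score_le {n : ℕ} (ε Δ L B : ℝ) (G H : SimpleGraph (Fin n)) (T : Finset (Fin n)) (j : ℕ)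
    (hH : Hom Δ H) (hA : Agree G H T) : score ε Δ L B G j ≤ flat L B H j + ε / 2 * T.card :=
  csInf_le (Set.toFinite _).bddBelow ⟨(H, T), ⟨hH, hA⟩, rfl⟩

lemma score_mem {n : ℕ} (ε Δ L B : ℝ) (hΔ : 0 ≤ Δ) (G : SimpleGraph (Fin n)) (j : ℕ) :
    ∃ (H : SimpleGraph (Fin n)) (T : Finset (Fin n)), Hom Δ H ∧ Agree G H T ∧
      score ε Δ L B G j = flat L B H j + ε / 2 * T.card := by
  have hne : ((fun p : SimpleGraph (Fin n) × Finset (Fin n) =>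
      flat L B p.1 j + ε / 2 * p.2.card) '' {p | Hom Δ p.1 ∧ Agree G p.1 p.2}).Nonempty :=
    ⟨_, (⊥, Finset.univ), ⟨hom_bot Δ hΔ, by intro a b h; simp at h⟩, rfl⟩
  obtain ⟨⟨H, T⟩, ⟨h1, h2⟩, h3⟩ := hne.csInf_mem (Set.toFinite _)
  exact ⟨H, T, h1, h2, h3.symm⟩

lemma score_rewire {n : ℕ} (ε Δ L B : ℝ) (hε : 0 ≤ ε) (hΔ : 0 ≤ Δ) (G G' : SimpleGraph (Fin n))
    (j : ℕ) (h : Rewire G G') : score ε Δ L B G j ≤ score ε Δ L B G' j + ε / 2 := by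
  classical
  obtain ⟨H, T, h1, h2, h3⟩ := score_mem ε Δ L B hΔ G' j
  obtain ⟨v, hv⟩ := h
  have h4 := score_le ε Δ L B G H (insert v T) j h1 (by
    intro a b ha hb
    simp only [Finset.mem_insert, not_or] at ha hb
    rw [hv a b ha.1 hb.1, h2 a b ha.2 hb.2])
  have h5 : ((insert v T).card : ℝ) ≤ T.card + 1 := by exact_mod_cast Finset.card_insert_le v T
  nlinarith

lemma Rewire.symm' {n : ℕ} {G G' : SimpleGraph (Fin n)} (h : Rewire G G') : Rewire G' G := by
  obtain ⟨v, hv⟩ := h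
  exact ⟨v, fun a b ha hb => (hv a b ha hb).symm⟩

/-- Any two graphs are joined by a chain of rewirings of length `nodeDist`. -/
lemma nodeDist_chain {n : ℕ} (G G' : SimpleGraph (Fin n)) :
    ∃ f : ℕ → SimpleGraph (Fin n),
      f 0 = G ∧ f (nodeDist G G') = G' ∧ ∀ i < nodeDist G G', Rewire (f i) (f (i + 1)) := by
  have hne : {m : ℕ | ∃ f : ℕ → SimpleGraph (Fin n),
    f 0 = G ∧ f m = G' ∧ ∀ i < m, Rewire (f i) (f (i + 1))}.Nonempty := by
    refine ⟨n, fun i => { Adj := fun a b => ((a.val < i ∨ b.val < i) ∧ G'.Adj a b) ∨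
        (¬ (a.val < i ∨ b.val < i) ∧ G.Adj a b)
                          symm := ⟨?_⟩
                          loopless := ⟨?_⟩ }, ?_, ?_, ?_⟩
    · intro a b h
      rw [or_comm (a := b.val < i), G'.adj_comm b a, G.adj_comm b a]
      exact h
    · intro a h
      simp at h
    · ext a b; simp
    · ext a b; simp [a.isLt]
    · intro i hi
      refine ⟨⟨i, hi⟩, ?_⟩
      intro a b ha hb
      have ha' : a.val ≠ i := fun h => ha (Fin.ext h)
      have hb' : b.val ≠ i := fun h => hb (Fin.ext h)
      have e1 : a.val < i + 1 ↔ a.val < i := by omega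
      have e2 : b.val < i + 1 ↔ b.val < i := by omega
      simp only [e1, e2]
  exact Nat.sInf_mem hne

lemma score_nodeDist {n : ℕ} (ε Δ L B : ℝ) (hε : 0 ≤ ε) (hΔ : 0 ≤ Δ) (G G' : SimpleGraph (Fin n))
    (j : ℕ) : |score ε Δ L B G j - score ε Δ L B G' j| ≤ ε / 2 * nodeDist G G' := by
  obtain ⟨f, h0, h1, h2⟩ := nodeDist_chain G G'
  have key : ∀ k ≤ nodeDist G G',
      |score ε Δ L B G j - score ε Δ L B (f k) j| ≤ ε / 2 * k := by
    intro k
    induction k with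
    | zero => intro _; rw [h0]; simp
    | succ k ih =>
      intro hk
      have a1 := ih (by omega)
      have a2 := score_rewire ε Δ L B hε hΔ _ _ j (h2 k (by omega))
      have a3 := score_rewire ε Δ L B hε hΔ _ _ j (h2 k (by omega)).symm'
      rw [abs_le] at a1 ⊢
      push_cast
      constructor <;> linarith
  have := key _ le_rfl
  rwa [h1] at this

lemma hom_close {n : ℕ} (hn : 2 ≤ n) (Δ : ℝ) (G H : SimpleGraph (Fin n))
    (T : Finset (Fin n)) (hG : Hom Δ G) (hH : Hom Δ H) (hA : Agree G H T) (hT : 8 * T.card ≤ n) :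
    |(edgeCount G : ℝ) - edgeCount H| ≤ 4 * T.card * Δ := by
  classical
  have hN : ((allE n).card : ℝ) = n * (n - 1) / 2 := by
    rw [card_allE, Nat.cast_choose_two]
  have hn' : (2 : ℝ) ≤ n := by exact_mod_cast hn
  have hNpos : (0 : ℝ) < (allE n).card := by rw [hN]; nlinarith
  have hq : ((touch T).card : ℝ) / (allE n).card ≤ 1 / 2 := by
    rw [div_le_iff₀ hNpos, hN]
    have h1 : ((touch T).card : ℝ) ≤ T.card * n := by exact_mod_cast card_touch_le T
    have h2 : (8 : ℝ) * T.card ≤ n := by exact_mod_cast hT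
    nlinarith
  have hsd : es G \ touch T = es H \ touch T := by
    have aux : ∀ e : Sym2 (Fin n), e ∉ touch T → (e ∈ es G ↔ e ∈ es H) := by
      intro e he
      by_cases hE : e ∈ allE n
      · simp only [touch, Finset.mem_filter, hE, true_and, not_exists, not_and] at he
        rw [mem_es, mem_es]
        induction e using Sym2.ind with
        | _ a b =>
          rw [SimpleGraph.mem_edgeSet, SimpleGraph.mem_edgeSet]
          exact hA a b (fun h => he a h (Sym2.mem_mk_left a b))
            (fun h => he b h (Sym2.mem_mk_right a b))
      · exact ⟨fun h => absurd (es_subset G h) hE, fun h => absurd (es_subset H h) hE⟩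
    ext e
    simp only [Finset.mem_sdiff]
    constructor
    · rintro ⟨h1, h2⟩; exact ⟨(aux e h2).1 h1, h2⟩
    · rintro ⟨h1, h2⟩; exact ⟨(aux e h2).2 h1, h2⟩
  have cG : ((es G ∩ touch T).card : ℝ) + (es G \ touch T).card = edgeCount G := by
    rw [← card_es]; exact_mod_cast Finset.card_inter_add_card_sdiff (es G) (touch T)
  have cH : ((es H ∩ touch T).card : ℝ) + (es G \ touch T).card = edgeCount H := by
    rw [hsd, ← card_es]; exact_mod_cast Finset.card_inter_add_card_sdiff (es H) (touch T)
  have bG := hG T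
  have bH := hH T
  set q := ((touch T).card : ℝ) / (allE n).card
  rw [abs_le] at bG bH ⊢
  constructor
  · by_contra hc
    push Not at hc
    have : (edgeCount G : ℝ) - edgeCount H ≤ 0 := by
      by_contra h'
      push Not at h'
      nlinarith
    nlinarith
  · by_contra hc
    push Not at hc
    have : 0 ≤ (edgeCount G : ℝ) - edgeCount H := by
      by_contra h'
      push Not at h'
      nlinarith
    nlinarith

lemma score_hom {n : ℕ} (hn : 2 ≤ n) (ε Δ L B : ℝ) (hε : 0 ≤ ε) (hΔ : 0 ≤ Δ) (hL : 0 ≤ L)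
    (hLΔ : L * (8 * Δ) ≤ ε) (hB : 16 * B ≤ ε * n) (G : SimpleGraph (Fin n)) (hG : Hom Δ G)
    (j : ℕ) : score ε Δ L B G j = flat L B G j := by
  apply le_antisymm
  · have := score_le ε Δ L B G G ∅ j hG (fun a b _ _ => Iff.rfl)
    simpa using this
  · obtain ⟨H, T, h1, h2, h3⟩ := score_mem ε Δ L B hΔ G j
    rw [h3]
    have hT0 : (0 : ℝ) ≤ T.card := by positivity
    unfold flat
    rcases le_or_gt (8 * T.card) n with hT | hT
    · have hc := hom_close hn Δ G H T hG h1 h2 hT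
      have htri : |(j : ℝ) - edgeCount G| ≤ |(j : ℝ) - edgeCount H| + 4 * T.card * Δ := by
        have := abs_sub_le (j : ℝ) (edgeCount H) (edgeCount G)
        rw [abs_sub_comm (edgeCount H : ℝ)] at this
        linarith
      have hm := mul_le_mul_of_nonneg_left htri hL
      have hm2 := mul_le_mul_of_nonneg_right hLΔ hT0
      rcases min_choice (L * |(j : ℝ) - edgeCount H|) B with h | h <;> rw [h]
      · refine (min_le_left _ _).trans ?_
        nlinarith
      · refine (min_le_right _ _).trans ?_
        nlinarith
    · have hT' : (n : ℝ) < 8 * T.card := by exact_mod_cast hT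
      have : B ≤ ε / 2 * T.card := by nlinarith
      rcases min_choice (L * |(j : ℝ) - edgeCount H|) B with h | h <;> rw [h]
      · refine (min_le_right _ _).trans ?_
        have : 0 ≤ L * |(j : ℝ) - edgeCount H| := by positivity
        linarith
      · refine (min_le_right _ _).trans ?_
        nlinarith

/-- The finitely supported probability measure with weights `w j` at `j / N`, `0 ≤ j ≤ 2N`. -/
def mech (N : ℕ) (w : ℕ → ℝ) : Measure ℝ :=
  ∑ j ∈ Finset.range (2 * N + 1),
    ENNReal.ofReal (w j / ∑ i ∈ Finset.range (2 * N + 1), w i) • Measure.dirac ((j : ℝ) / N)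

lemma mech_Z_pos (N : ℕ) (w : ℕ → ℝ) (hw : ∀ j, 0 < w j) :
    0 < ∑ i ∈ Finset.range (2 * N + 1), w i :=
  Finset.sum_pos (fun i _ => hw i) ⟨0, by simp⟩

lemma mech_prob (N : ℕ) (w : ℕ → ℝ) (hw : ∀ j, 0 < w j) : IsProbabilityMeasure (mech N w) := by
  constructor
  have hZ := mech_Z_pos N w hw
  rw [mech, Measure.finsetSum_apply]
  simp only [Measure.smul_apply, measure_univ, smul_eq_mul, mul_one]
  rw [← ENNReal.ofReal_sum_of_nonneg (fun i _ => (div_pos (hw i) hZ).le), ← Finset.sum_div,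
    div_self hZ.ne', ENNReal.ofReal_one]

lemma mech_private (N : ℕ) (w w' : ℕ → ℝ) (hw : ∀ j, 0 < w j) (hw' : ∀ j, 0 < w' j) (a : ℝ)
    (h1 : ∀ j, w j ≤ Real.exp a * w' j) (h2 : ∀ j, w' j ≤ Real.exp a * w j) (S : Set ℝ) :
    mech N w S ≤ ENNReal.ofReal (Real.exp (2 * a)) * mech N w' S := by
  have hZ := mech_Z_pos N w hw
  have hZ' := mech_Z_pos N w' hw'
  rw [mech, mech, Measure.finsetSum_apply, Measure.finsetSum_apply, Finset.mul_sum]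
  apply Finset.sum_le_sum
  intro j _
  simp only [Measure.smul_apply, smul_eq_mul]
  rw [← mul_assoc, ← ENNReal.ofReal_mul (Real.exp_pos _).le]
  gcongr
  rw [← mul_div_assoc, div_le_div_iff₀ hZ hZ', two_mul a, Real.exp_add]
  have h3 : ∑ i ∈ Finset.range (2 * N + 1), w' i
      ≤ Real.exp a * ∑ i ∈ Finset.range (2 * N + 1), w i := by
    rw [Finset.mul_sum]
    exact Finset.sum_le_sum (fun i _ => h2 i)
  calc w j * ∑ i ∈ Finset.range (2 * N + 1), w' i
      ≤ (Real.exp a * w' j) * (Real.exp a * ∑ i ∈ Finset.range (2 * N + 1), w i) :=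
        mul_le_mul (h1 j) h3 hZ'.le (mul_pos (Real.exp_pos _) (hw' j)).le
    _ = _ := by ring

lemma mech_integral (N : ℕ) (w : ℕ → ℝ) (hw : ∀ j, 0 < w j) (f : ℝ → ℝ) :
    ∫ x, f x ∂(mech N w) = (∑ j ∈ Finset.range (2 * N + 1), w j * f ((j : ℝ) / N))
      / ∑ i ∈ Finset.range (2 * N + 1), w i := by
  have hZ := mech_Z_pos N w hw
  rw [mech, integral_finsetSum_measure, Finset.sum_div]
  · apply Finset.sum_congr rfl
    intro j _
    rw [integral_smul_measure, integral_dirac, ENNReal.toReal_ofReal (div_pos (hw j) hZ).le,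
      smul_eq_mul]
    ring
  · intro j _
    exact (integrable_dirac (by simp)).smul_measure ENNReal.ofReal_ne_top

lemma sum_sq_geom_le (K : ℕ) (r : ℝ) (h0 : 0 ≤ r) (h1 : r < 1) :
    ∑ i ∈ Finset.range K, (i : ℝ) ^ 2 * r ^ i ≤ 2 / (1 - r) ^ 3 := by
  have hs := hasSum_choose_mul_geometric_of_norm_lt_one (𝕜 := ℝ) 2 (r := r)
    (by rw [Real.norm_of_nonneg h0]; exact h1)
  have h2 := sum_le_hasSum (Finset.range K) (fun i _ => by positivity) hs
  have h3 : ∑ i ∈ Finset.range K, (i : ℝ) ^ 2 * r ^ i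
      ≤ 2 * ∑ i ∈ Finset.range K, ((i + 2).choose 2 : ℝ) * r ^ i := by
    rw [Finset.mul_sum]
    apply Finset.sum_le_sum
    intro i _
    rw [← mul_assoc]
    gcongr
    rw [Nat.cast_choose_two]
    push_cast
    have : (0 : ℝ) ≤ i := by positivity
    nlinarith
  calc _ ≤ _ := h3
    _ ≤ 2 * (1 / (1 - r) ^ (2 + 1)) := by gcongr
    _ = _ := by ring

lemma flat_error (N m : ℕ) (hN : 1 ≤ N) (hm : m ≤ N) (L B : ℝ) (hL : 0 < L) (hL1 : L ≤ 1 / 2)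
    (hLN : 1 ≤ L * N) (w : ℕ → ℝ)
    (hw : ∀ j, w j = Real.exp (-(min (L * |(j : ℝ) - m|) B))) :
    (∑ j ∈ Finset.range (2 * N + 1), w j * |(j : ℝ) / N - (m : ℝ) / N| ^ 2)
      / (∑ i ∈ Finset.range (2 * N + 1), w i)
      ≤ 32 / ((N : ℝ) ^ 2 * L ^ 2) + 12 * N * Real.exp (-B) := by
  have hN' : (1 : ℝ) ≤ N := by exact_mod_cast hN
  have hm' : (m : ℝ) ≤ N := by exact_mod_cast hm
  set r := Real.exp (-L) with hr
  have hr0 : 0 < r := Real.exp_pos _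
  have hr1 : L / 2 ≤ 1 - r := by
    have := (abs_le.1 (Real.abs_exp_sub_one_sub_id_le (x := -L)
      (by rw [abs_neg, abs_of_pos hL]; linarith))).2
    nlinarith
  have hr2 : r < 1 := by linarith
  have hrpow : ∀ i : ℕ, Real.exp (-(L * i)) = r ^ i := by
    intro i
    rw [hr, ← Real.exp_nat_mul]; congr 1; ring
  have hwpos : ∀ j, 0 < w j := fun j => by rw [hw]; exact Real.exp_pos _
  set Z := ∑ i ∈ Finset.range (2 * N + 1), w i with hZ
  have hwm : ∀ i : ℕ, r ^ i ≤ w (m + i) := by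
    intro i
    rw [hw, ← hrpow]
    apply Real.exp_le_exp.2
    have : |((m + i : ℕ) : ℝ) - m| = i := by push_cast; rw [add_sub_cancel_left]; simp
    rw [this]
    linarith [min_le_left (L * (i : ℝ)) B]
  have hZg : ∑ i ∈ Finset.range (N + 1), r ^ i ≤ Z := by
    calc _ ≤ ∑ i ∈ Finset.range (N + 1), w (m + i) := Finset.sum_le_sum (fun i _ => hwm i)
      _ ≤ ∑ i ∈ Finset.range m, w i + ∑ i ∈ Finset.range (N + 1), w (m + i) := by
        have := Finset.sum_nonneg (s := Finset.range m) (fun i _ => (hwpos i).le)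
        linarith
      _ = ∑ i ∈ Finset.range (m + (N + 1)), w i := (Finset.sum_range_add w m (N + 1)).symm
      _ ≤ Z := by
        apply Finset.sum_le_sum_of_subset_of_nonneg
        · intro i; simp; omega
        · intro i _ _; exact (hwpos i).le
  have hZ1 : 1 ≤ Z := by
    refine le_trans ?_ hZg
    rw [Finset.sum_range_succ']
    have := Finset.sum_nonneg (s := Finset.range N) (fun i _ => pow_nonneg hr0.le (i + 1))
    simpa using this
  have hZ2 : 1 / 2 ≤ Z * (1 - r) := by
    have hg : (∑ i ∈ Finset.range (N + 1), r ^ i) * (1 - r) = 1 - r ^ (N + 1) :=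
      geom_sum_mul_neg r (N + 1)
    have hrN : r ^ (N + 1) ≤ 1 / 2 := by
      rw [← hrpow]
      calc Real.exp (-(L * ((N + 1 : ℕ) : ℝ))) ≤ Real.exp (-1) := by
            apply Real.exp_le_exp.2
            push_cast; nlinarith
        _ ≤ 1 / 2 := by
            rw [Real.exp_neg, inv_eq_one_div]
            apply one_div_le_one_div_of_le (by norm_num)
            linarith [Real.add_one_le_exp 1]
    nlinarith [mul_le_mul_of_nonneg_right hZg (by linarith : 0 ≤ 1 - r)]
  -- numerator
  have hwle : ∀ j, w j ≤ Real.exp (-(L * |(j : ℝ) - m|)) + Real.exp (-B) := by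
    intro j
    rw [hw]
    rcases min_choice (L * |(j : ℝ) - m|) B with h | h <;> rw [h]
    · linarith [Real.exp_pos (-B)]
    · linarith [Real.exp_pos (-(L * |(j : ℝ) - m|))]
  have hsplit : ∑ j ∈ Finset.range (2 * N + 1),
      Real.exp (-(L * |(j : ℝ) - m|)) * |(j : ℝ) - m| ^ 2 ≤ 4 / (1 - r) ^ 3 := by
    have e : 2 * N + 1 = m + (2 * N + 1 - m) := by omega
    rw [e, Finset.sum_range_add]
    have s1 : ∑ j ∈ Finset.range m, Real.exp (-(L * |(j : ℝ) - m|)) * |(j : ℝ) - m| ^ 2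
        ≤ 2 / (1 - r) ^ 3 := by
      refine le_trans ?_ (sum_sq_geom_le (m + 1) r hr0.le hr2)
      rw [Finset.sum_range_succ', ← Finset.sum_range_reflect]
      simp only [Nat.cast_zero, ne_eq, OfNat.ofNat_ne_zero, not_false_eq_true, zero_pow, zero_mul,
        add_zero]
      apply le_of_eq
      apply Finset.sum_congr rfl
      intro j hj
      have hj' : j < m := Finset.mem_range.1 hj
      have e2 : |((m - 1 - j : ℕ) : ℝ) - m| = ((j + 1 : ℕ) : ℝ) := by
        have : ((m - 1 - j : ℕ) : ℝ) + ((j + 1 : ℕ) : ℝ) = m := by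
          exact_mod_cast (by omega : (m - 1 - j) + (j + 1) = m)
        rw [← this, sub_add_cancel_left, abs_neg, Nat.abs_cast]
      rw [e2, hrpow, mul_comm]
    have s2 : ∑ j ∈ Finset.range (2 * N + 1 - m),
        Real.exp (-(L * |((m + j : ℕ) : ℝ) - m|)) * |((m + j : ℕ) : ℝ) - m| ^ 2
        ≤ 2 / (1 - r) ^ 3 := by
      refine le_trans ?_ (sum_sq_geom_le (2 * N + 1 - m) r hr0.le hr2)
      apply le_of_eq
      apply Finset.sum_congr rfl
      intro j _
      have : |((m + j : ℕ) : ℝ) - m| = j := by push_cast; rw [add_sub_cancel_left]; simp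
      rw [this, hrpow, mul_comm]
    calc _ ≤ 2 / (1 - r) ^ 3 + 2 / (1 - r) ^ 3 := add_le_add s1 s2
      _ = _ := by ring
  have hnum : ∑ j ∈ Finset.range (2 * N + 1), w j * |(j : ℝ) / N - (m : ℝ) / N| ^ 2
      ≤ 1 / (N : ℝ) ^ 2 * (4 / (1 - r) ^ 3) + 12 * N * Real.exp (-B) := by
    have hb : ∀ j ∈ Finset.range (2 * N + 1), w j * |(j : ℝ) / N - (m : ℝ) / N| ^ 2
        ≤ 1 / (N : ℝ) ^ 2 * (Real.exp (-(L * |(j : ℝ) - m|)) * |(j : ℝ) - m| ^ 2)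
          + 4 * Real.exp (-B) := by
      intro j hj
      have hj' : (j : ℝ) ≤ 2 * N := by
        have := Finset.mem_range.1 hj
        exact_mod_cast (by omega : j ≤ 2 * N)
      have e3 : |(j : ℝ) / N - (m : ℝ) / N| ^ 2 = 1 / (N : ℝ) ^ 2 * |(j : ℝ) - m| ^ 2 := by
        rw [← sub_div, abs_div, div_pow, Nat.abs_cast]; ring
      have e4 : |(j : ℝ) / N - (m : ℝ) / N| ^ 2 ≤ 4 := by
        rw [e3, one_div_mul_eq_div, div_le_iff₀ (by positivity), sq_abs]
        have hj0 : (0 : ℝ) ≤ j := by positivity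
        have hm0 : (0 : ℝ) ≤ m := by positivity
        nlinarith
      calc w j * |(j : ℝ) / N - (m : ℝ) / N| ^ 2
          ≤ (Real.exp (-(L * |(j : ℝ) - m|)) + Real.exp (-B)) * |(j : ℝ) / N - (m : ℝ) / N| ^ 2 := by
            gcongr; exact hwle j
        _ = Real.exp (-(L * |(j : ℝ) - m|)) * |(j : ℝ) / N - (m : ℝ) / N| ^ 2
            + |(j : ℝ) / N - (m : ℝ) / N| ^ 2 * Real.exp (-B) := by ring
        _ ≤ Real.exp (-(L * |(j : ℝ) - m|)) * |(j : ℝ) / N - (m : ℝ) / N| ^ 2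
            + 4 * Real.exp (-B) := by gcongr
        _ = _ := by rw [e3]; ring
    refine (Finset.sum_le_sum hb).trans ?_
    rw [Finset.sum_add_distrib, ← Finset.mul_sum, Finset.sum_const, nsmul_eq_mul, Finset.card_range]
    apply add_le_add
    · gcongr
    · push_cast
      have := Real.exp_pos (-B)
      nlinarith
  have hZpos : 0 < Z := by linarith
  have hr3 : 0 < 1 - r := by linarith
  rw [div_le_iff₀ hZpos]
  refine hnum.trans ?_
  rw [add_mul]
  apply add_le_add
  · have h5 : 4 / (1 - r) ^ 3 ≤ 32 / L ^ 2 * Z := by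
      rw [div_le_iff₀ (by positivity)]
      have h6 : L ^ 2 / 4 ≤ (1 - r) ^ 2 := by nlinarith
      calc (4 : ℝ) = 32 / L ^ 2 * (1 / 2) * (L ^ 2 / 4) := by field_simp; norm_num
        _ ≤ 32 / L ^ 2 * (Z * (1 - r)) * (1 - r) ^ 2 := by gcongr
        _ = _ := by ring
    calc 1 / (N : ℝ) ^ 2 * (4 / (1 - r) ^ 3) ≤ 1 / (N : ℝ) ^ 2 * (32 / L ^ 2 * Z) := by gcongr
      _ = _ := by field_simp
  · have : 0 ≤ 12 * N * Real.exp (-B) := by positivity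
    nlinarith

lemma bad_error (N m : ℕ) (hN : 1 ≤ N) (hm : m ≤ N) (w : ℕ → ℝ) (hw : ∀ j, 0 < w j) :
    (∑ j ∈ Finset.range (2 * N + 1), w j * |(j : ℝ) / N - (m : ℝ) / N| ^ 2)
      / (∑ i ∈ Finset.range (2 * N + 1), w i) ≤ 4 := by
  have hN' : (1 : ℝ) ≤ N := by exact_mod_cast hN
  have hm' : (m : ℝ) ≤ N := by exact_mod_cast hm
  rw [div_le_iff₀ (mech_Z_pos N w hw), Finset.mul_sum]
  apply Finset.sum_le_sum
  intro j hj
  have hj' : (j : ℝ) ≤ 2 * N := by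
    have := Finset.mem_range.1 hj
    exact_mod_cast (by omega : j ≤ 2 * N)
  rw [mul_comm]
  apply mul_le_mul_of_nonneg_right _ (hw j).le
  rw [← sub_div, sq_abs, div_pow, div_le_iff₀ (by positivity)]
  have hj0 : (0 : ℝ) ≤ j := by positivity
  have hm0 : (0 : ℝ) ≤ m := by positivity
  nlinarith

/-- The algorithm. -/
def algo (ε Δ L B : ℝ) (n : ℕ) (G : SimpleGraph (Fin n)) : Measure ℝ :=
  mech (n.choose 2) (fun j => Real.exp (-(score ε Δ L B G j)))

lemma algo_private (ε Δ L B : ℝ) (hε : 0 ≤ ε) (hΔ : 0 ≤ Δ) (n : ℕ) (G G' : SimpleGraph (Fin n))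
    (S : Set ℝ) : algo ε Δ L B n G S
      ≤ ENNReal.ofReal (Real.exp (ε * (nodeDist G G' : ℝ))) * algo ε Δ L B n G' S := by
  have e : ε * (nodeDist G G' : ℝ) = 2 * (ε / 2 * nodeDist G G') := by ring
  rw [e]
  apply mech_private _ _ _ (fun _ => Real.exp_pos _) (fun _ => Real.exp_pos _)
  · intro j
    rw [← Real.exp_add]
    apply Real.exp_le_exp.2
    have := (abs_le.1 (score_nodeDist ε Δ L B hε hΔ G G' j)).1
    linarith
  · intro j
    rw [← Real.exp_add]
    apply Real.exp_le_exp.2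
    have := (abs_le.1 (score_nodeDist ε Δ L B hε hΔ G G' j)).2
    linarith

/-- Averaging over `G(n,m)`. -/
lemma gnm_integral_le (n m : ℕ) (g : SimpleGraph (Fin n) → ℝ) (P : SimpleGraph (Fin n) → Prop)
    (a b : ℝ) (ha : 0 ≤ a) (hP : ∀ G, edgeCount G = m → P G → g G ≤ a)
    (hb : ∀ G, g G ≤ b) :
    ∫ G, g G ∂(gnm n m) ≤ a + b * (gnm n m).real {G | ¬ P G} := by
  classical
  have : MeasurableSingletonClass (SimpleGraph (Fin n)) :=
    ⟨fun _ => MeasurableSpace.measurableSet_top⟩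
  have : IsZeroOrProbabilityMeasure (gnm n m) := by unfold gnm; infer_instance
  have hae : ∀ᵐ G ∂(gnm n m), g G ≤ a + Set.indicator {G | ¬ P G} (fun _ => b) G := by
    have hmem : ∀ᵐ G ∂(gnm n m), G ∈ {G : SimpleGraph (Fin n) | edgeCount G = m} := by
      unfold gnm uniformOn
      exact ae_cond_mem MeasurableSpace.measurableSet_top
    filter_upwards [hmem] with G hG
    by_cases h : P G
    · simp only [Set.indicator, Set.mem_ofPred_eq, h, not_true_eq_false, if_false, add_zero]
      exact hP G hG h
    · simp only [Set.indicator, Set.mem_ofPred_eq, h, not_false_eq_true, if_true]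
      linarith [hb G]
  refine (integral_mono_ae Integrable.of_finite Integrable.of_finite hae).trans ?_
  rw [integral_add Integrable.of_finite Integrable.of_finite, integral_const,
    integral_indicator_const _ MeasurableSpace.measurableSet_top]
  simp only [smul_eq_mul]
  have : (gnm n m).real Set.univ ≤ 1 := measureReal_le_one
  nlinarith

set_option maxHeartbeats 2000000 in
/-- The error bound at a fixed size `n`. -/
lemma error_bound (n m : ℕ) (ε ρ : ℝ) (hε : 0 < ε) (hε1 : ε < 1) (hρ : 0 < ρ) (hρ1 : ρ < 1)
    (hn : 3 ≤ n) (hl : 1 ≤ Real.log n) (hεn : 256 * Real.log n ≤ ε * n)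
    (hm : (m : ℝ) < ρ * (n.choose 2 : ℝ)) (Δ : ℝ)
    (hΔ : Δ = 8 * Real.sqrt (max ρ (Real.log n / n) * n * Real.log n)) :
    ∫ G, (∫ x, |x - (m : ℝ) / (n.choose 2 : ℝ)| ^ 2
        ∂(algo ε Δ (ε / (8 * Δ)) (ε * n / 16) n G)) ∂(gnm n m)
      ≤ 2097180 * max ρ (Real.log n / n) * Real.log n / ((n : ℝ) ^ 3 * ε ^ 2) := by
  set l := Real.log n with hldef
  have hn' : (3 : ℝ) ≤ n := by exact_mod_cast hn
  have hn0 : (0 : ℝ) < n := by linarith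
  have hln : l ≤ n := by
    have := Real.log_le_sub_one_of_pos hn0
    linarith
  set ρ' := max ρ (l / n) with hρ'
  have hρ'1 : ρ' ≤ 1 := max_le hρ1.le (by rw [div_le_one hn0]; exact hln)
  have hρ'l : l / n ≤ ρ' := le_max_right _ _
  have hρ'ρ : ρ ≤ ρ' := le_max_left _ _
  set σ := ρ' * n with hσ
  have hσl : l ≤ σ := by rw [div_le_iff₀ hn0] at hρ'l; exact hρ'l
  have hσ0 : 0 < σ := by linarith
  have hl0 : 0 < l := by linarith
  have hΔsq : Δ ^ 2 = 64 * (σ * l) := by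
    rw [hΔ, mul_pow, Real.sq_sqrt (by positivity)]; norm_num
  have hΔ8 : 8 ≤ Δ := by
    rw [hΔ]
    have : 1 ≤ Real.sqrt (σ * l) := Real.one_le_sqrt.2 (by nlinarith)
    linarith
  have hΔn : Δ ≤ 8 * n := by
    apply le_of_sq_le_sq _ (by positivity)
    rw [hΔsq]
    have : σ ≤ n := by nlinarith
    nlinarith
  have hNeq : ((n.choose 2 : ℕ) : ℝ) = n * (n - 1) / 2 := Nat.cast_choose_two ℝ n
  set N := n.choose 2 with hNdef
  have hNlow : (n : ℝ) ^ 2 / 4 ≤ N := by rw [hNeq]; nlinarith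
  have hNup : (N : ℝ) ≤ (n : ℝ) ^ 2 := by rw [hNeq]; nlinarith
  have hN1' : (1 : ℝ) ≤ N := by nlinarith
  have hN1 : 1 ≤ N := by exact_mod_cast hN1'
  have hmN' : (m : ℝ) ≤ N := by nlinarith
  have hmN : m ≤ N := by exact_mod_cast hmN'
  set L := ε / (8 * Δ) with hL
  have hL0 : 0 < L := by positivity
  have hL1 : L ≤ 1 / 2 := by
    rw [hL, div_le_iff₀ (by positivity)]; nlinarith
  have hLΔ : L * (8 * Δ) = ε := by rw [hL]; field_simp
  have hLN : 1 ≤ L * N := by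
    rw [hL, div_mul_eq_mul_div, le_div_iff₀ (by positivity)]
    have h1 : ε * ((n : ℝ) ^ 2 / 4) ≤ ε * N := by gcongr
    have h2 : 256 * n ≤ ε * n * n := by nlinarith
    nlinarith
  -- probability of bad graphs
  have hbad : (gnm n m).real {G | ¬ Hom Δ G} ≤ 4 / (n : ℝ) ^ 6 := by
    have hcard : (allE n).card = N := card_allE n
    set lam := Real.sqrt (l / σ) with hlam
    have hlamsq : lam ^ 2 = l / σ := Real.sq_sqrt (by positivity)
    have hlam1 : lam ≤ 1 := Real.sqrt_le_one.2 (by rw [div_le_one hσ0]; exact hσl)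
    have hlamΔ : lam * Δ = 8 * l := by
      rw [hΔ, hlam, mul_left_comm, ← Real.sqrt_mul (by positivity)]
      have : l / σ * (σ * l) = l ^ 2 := by field_simp
      rw [this, Real.sqrt_sq hl0.le]
    have hb := gnm_bad n m (by rw [hcard]; exact hN1) σ lam Δ (Real.sqrt_nonneg _) hlam1 (by
      rw [hcard, div_le_iff₀ (by linarith)]
      have h1 : (m : ℝ) ≤ ρ' * N := by nlinarith
      calc (m : ℝ) * n ≤ ρ' * N * n := by gcongr
        _ = σ * N := by rw [hσ]; ring)
    refine hb.trans ?_
    have hexp : Real.exp (σ * lam ^ 2 - lam * Δ) = 1 / (n : ℝ) ^ 7 := by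
      rw [hlamsq, hlamΔ]
      have : σ * (l / σ) - 8 * l = -(((7 : ℕ) : ℝ) * l) := by field_simp; push_cast; ring
      rw [this, Real.exp_neg, Real.exp_nat_mul, hldef, Real.exp_log hn0, one_div]
    rw [hexp]
    set y : ℝ := 1 / (n : ℝ) ^ 6 with hy
    have hy0 : 0 ≤ y := by positivity
    have hy1 : y ≤ 1 := by
      rw [hy, div_le_one (by positivity)]
      exact one_le_pow₀ (by linarith)
    have hpow : (1 + 1 / (n : ℝ) ^ 7) ^ n ≤ 1 + 2 * y := by
      calc (1 + 1 / (n : ℝ) ^ 7) ^ n ≤ (Real.exp (1 / (n : ℝ) ^ 7)) ^ n := by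
            gcongr
            linarith [Real.add_one_le_exp (1 / (n : ℝ) ^ 7)]
        _ = Real.exp y := by
            rw [← Real.exp_nat_mul]; congr 1; rw [hy]; field_simp
        _ ≤ 1 + 2 * y := by
            have := (abs_le.1 (Real.abs_exp_sub_one_sub_id_le (x := y)
              (by rw [abs_of_nonneg hy0]; exact hy1))).2
            nlinarith
    have : 4 / (n : ℝ) ^ 6 = 4 * y := by rw [hy]; ring
    rw [this]
    linarith
  have hmain := gnm_integral_le n m
    (fun G => ∫ x, |x - (m : ℝ) / (N : ℝ)| ^ 2 ∂(algo ε Δ L (ε * n / 16) n G)) (Hom Δ)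
    (32 / ((N : ℝ) ^ 2 * L ^ 2) + 12 * N * Real.exp (-(ε * n / 16))) 4 (by positivity)
    (by
      intro G hG hH
      simp only [algo]
      rw [mech_integral _ _ (fun _ => Real.exp_pos _)]
      apply flat_error N m hN1 hmN L _ hL0 hL1 hLN
      intro j
      rw [score_hom (by omega) ε Δ L _ hε.le (by linarith) hL0.le hLΔ.le (by linarith) G hH,
        flat, hG])
    (by
      intro G
      simp only [algo]
      rw [mech_integral _ _ (fun _ => Real.exp_pos _)]
      exact bad_error N m hN1 hmN _ (fun _ => Real.exp_pos _))
  refine hmain.trans ?_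
  set R := ρ' * l / ((n : ℝ) ^ 3 * ε ^ 2) with hR
  have hR4 : 1 / (n : ℝ) ^ 4 ≤ R := by
    rw [hR, div_le_div_iff₀ (by positivity) (by positivity)]
    have h1 : 1 ≤ σ * l := by nlinarith
    have h2 : ε ^ 2 ≤ 1 := by nlinarith
    calc 1 * ((n : ℝ) ^ 3 * ε ^ 2) ≤ (n : ℝ) ^ 3 * 1 := by
          rw [one_mul]; gcongr
      _ ≤ (n : ℝ) ^ 3 * (σ * l) := by gcongr
      _ = _ := by rw [hσ]; ring
  have hterm1 : 32 / ((N : ℝ) ^ 2 * L ^ 2) ≤ 2097152 * R := by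
    have hL2 : L ^ 2 = ε ^ 2 / (4096 * (σ * l)) := by
      rw [hL, div_pow, mul_pow, hΔsq]; ring
    calc 32 / ((N : ℝ) ^ 2 * L ^ 2) ≤ 32 / (((n : ℝ) ^ 2 / 4) ^ 2 * L ^ 2) := by gcongr
      _ = 2097152 * R := by
        rw [hL2, hR, hσ]
        field_simp
        ring
  have hterm2 : 12 * N * Real.exp (-(ε * n / 16)) ≤ 12 * R := by
    have he : Real.exp (-(ε * n / 16)) ≤ 1 / (n : ℝ) ^ 6 := by
      calc Real.exp (-(ε * n / 16)) ≤ Real.exp (-(((6 : ℕ) : ℝ) * l)) := by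
            apply Real.exp_le_exp.2
            push_cast; linarith
        _ = 1 / (n : ℝ) ^ 6 := by
            rw [Real.exp_neg, Real.exp_nat_mul, hldef, Real.exp_log hn0, one_div]
    calc 12 * N * Real.exp (-(ε * n / 16)) ≤ 12 * (n : ℝ) ^ 2 * (1 / (n : ℝ) ^ 6) := by gcongr
      _ = 12 * (1 / (n : ℝ) ^ 4) := by field_simp
      _ ≤ 12 * R := by gcongr
  have hterm3 : 4 * (gnm n m).real {G | ¬ Hom Δ G} ≤ 16 * R := by
    have h6 : 4 / (n : ℝ) ^ 6 ≤ 4 * (1 / (n : ℝ) ^ 4) := by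
      rw [mul_one_div]
      apply div_le_div_of_nonneg_left (by norm_num) (by positivity)
      exact pow_le_pow_right₀ (by linarith) (by norm_num)
    linarith
  calc _ ≤ 2097180 * R := by linarith
    _ = _ := by rw [hR]; ring

/-- For sequences `ε_n, ρ_n ∈ (0,1)` with `ε_n·n/log n → ∞`, there are a constant `K`, an
index `n₀`, and `ε_n`-node differentially private algorithms `A_n` (mapping graphs on `n`
vertices to probability measures on `ℝ`) such that for all `n ≥ n₀` and all `m < ρ_n·C(n,2)`,
`E_{G ∼ G(n,m), x ∼ A_n(G)}[|x − m/C(n,2)|²] ≤ K·max{ρ_n, (log n)/n}·(log n)/(n³·ε_n²)`. -/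
theorem gnm_private_density_estimation (ε ρ : ℕ → ℝ)
    (hε : ∀ n, ε n ∈ Set.Ioo (0 : ℝ) 1) (hρ : ∀ n, ρ n ∈ Set.Ioo (0 : ℝ) 1)
    (hlim : Filter.Tendsto (fun n : ℕ => ε n * (n : ℝ) / Real.log n) Filter.atTop Filter.atTop) :
    ∃ K : ℝ, ∃ n₀ : ℕ, ∃ A : (n : ℕ) → SimpleGraph (Fin n) → Measure ℝ,
      (∀ n : ℕ, ∀ G, IsProbabilityMeasure (A n G)) ∧
      (∀ n : ℕ, ∀ G G' : SimpleGraph (Fin n), ∀ S : Set ℝ, MeasurableSet S →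
        A n G S ≤ ENNReal.ofReal (Real.exp (ε n * (nodeDist G G' : ℝ))) * A n G' S) ∧
      (∀ n : ℕ, n₀ ≤ n → ∀ m : ℕ, (m : ℝ) < ρ n * (n.choose 2 : ℝ) →
        ∫ G, (∫ x, |x - (m : ℝ) / (n.choose 2 : ℝ)| ^ 2 ∂(A n G)) ∂(gnm n m)
          ≤ K * max (ρ n) (Real.log n / n) * Real.log n / ((n : ℝ) ^ 3 * (ε n) ^ 2)) := by
  have hev : ∀ᶠ n : ℕ in Filter.atTop, 3 ≤ n ∧ 1 ≤ Real.log n ∧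
      256 * Real.log n ≤ ε n * n := by
    have h1 : ∀ᶠ n : ℕ in Filter.atTop, 1 ≤ Real.log n :=
      (Real.tendsto_log_atTop.comp tendsto_natCast_atTop_atTop).eventually_ge_atTop 1
    filter_upwards [Filter.eventually_ge_atTop 3, h1, hlim.eventually_ge_atTop 256]
      with n h3 h4 h5
    refine ⟨h3, h4, ?_⟩
    rwa [le_div_iff₀ (by linarith)] at h5
  obtain ⟨n₀, hn₀⟩ := Filter.eventually_atTop.1 hev
  let Δ : ℕ → ℝ := fun n => 8 * Real.sqrt (max (ρ n) (Real.log n / n) * n * Real.log n)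
  have hΔ : ∀ n, 0 ≤ Δ n := fun n => by positivity
  refine ⟨2097180, n₀, fun n G => algo (ε n) (Δ n) (ε n / (8 * Δ n)) (ε n * n / 16) n G,
    ?_, ?_, ?_⟩
  · intro n G
    exact mech_prob _ _ (fun _ => Real.exp_pos _)
  · intro n G G' S _
    exact algo_private _ _ _ _ (hε n).1.le (hΔ n) n G G' S
  · intro n hn m hm
    obtain ⟨h3, h4, h5⟩ := hn₀ n hn
    exact error_bound n m (ε n) (ρ n) (hε n).1 (hε n).2 (hρ n).1 (hρ n).2 h3 h4 h5 hm (Δ n) rfl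

end
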